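/- Let κ = (κ₀,κ₁,κ₂,κ₃,κ₄) ∈ ℂ⁵ with 2κ₀+κ₁+κ₂+κ₃+κ₄ = 1, assume κ₄ ≠ 0, let ε ∈ {1,−1}, and assume κ₄ + εκ₃ is not an integer. Then there exist r ∈ (0,1) and functions q, p : ℂ → ℂ, both analytic on the ball {z : |z| < r}, such that q(0) = (κ₄ + εκ₃)/κ₄ and (q,p) solves P_VI(κ) at every z with 0 < |z| < r. (Painlevé VI admits a holomorphic solution germ at z = 0 with q(z) = (κ₄+εκ₃)/κ₄ + O(z).) -/

import Mathlib

/-- The sixth Painlevé system `P_VI(κ)` holds for the pair `(q, p)` at the point `z`. -/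
def SolvesPVIAt (κ₀ κ₁ κ₂ κ₃ κ₄ : ℂ) (q p : ℂ → ℂ) (z : ℂ) : Prop :=
  z * (z - 1) * deriv q z =
      2 * q z * (q z - 1) * (q z - z) * p z - κ₁ * (q z - 1) * (q z - z)
        - (κ₂ - 1) * q z * (q z - 1) - κ₃ * q z * (q z - z) ∧
  z * (z - 1) * deriv p z =
      -(3 * q z ^ 2 - 2 * (1 + z) * q z + z) * p z ^ 2
        + (κ₁ * (2 * q z - 1 - z) + (κ₂ - 1) * (2 * q z - 1) + κ₃ * (2 * q z - z)) * p z
        - κ₀ * (κ₀ + κ₄)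

open PowerSeries in
/-- Partial sums of the weighted `ℓ¹` norm `∑ ‖aₙ‖ sⁿ` of a formal power series. -/
noncomputable def partialNorm (s : ℝ) (N : ℕ) (f : ℂ⟦X⟧) : ℝ :=
  ∑ n ∈ Finset.range N, ‖coeff n f‖ * s ^ n

section PartialNorm

open PowerSeries

variable {s : ℝ} {N : ℕ} {f g : ℂ⟦X⟧}

lemma partialNorm_nonneg (hs : 0 ≤ s) : 0 ≤ partialNorm s N f :=
  Finset.sum_nonneg fun _ _ => by positivity

lemma partialNorm_add_le (hs : 0 ≤ s) :
    partialNorm s N (f + g) ≤ partialNorm s N f + partialNorm s N g := by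
  unfold partialNorm
  rw [← Finset.sum_add_distrib]
  refine Finset.sum_le_sum fun n _ => ?_
  rw [← add_mul, map_add]
  gcongr
  exact norm_add_le _ _

lemma partialNorm_neg : partialNorm s N (-f) = partialNorm s N f := by
  simp [partialNorm]

lemma partialNorm_mul_le (hs : 0 ≤ s) :
    partialNorm s N (f * g) ≤ partialNorm s N f * partialNorm s N g := by
  unfold partialNorm
  rw [Finset.sum_mul_sum, ← Finset.sum_product']
  calc ∑ n ∈ Finset.range N, ‖coeff n (f * g)‖ * s ^ n
      ≤ ∑ n ∈ Finset.range N, ∑ x ∈ Finset.HasAntidiagonal.antidiagonal n,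
          (‖coeff x.1 f‖ * s ^ x.1) * (‖coeff x.2 g‖ * s ^ x.2) := by
        refine Finset.sum_le_sum fun n _ => ?_
        rw [coeff_mul]
        calc _ ≤ (∑ x ∈ Finset.HasAntidiagonal.antidiagonal n, ‖coeff x.1 f * coeff x.2 g‖) * s ^ n := by
              gcongr
              exact norm_sum_le _ _
          _ = _ := by
              rw [Finset.sum_mul]
              refine Finset.sum_congr rfl fun x hx => ?_
              rw [← Finset.HasAntidiagonal.mem_antidiagonal.1 hx, norm_mul, pow_add]
              ring
    _ = ∑ x ∈ (Finset.range N).biUnion Finset.HasAntidiagonal.antidiagonal,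
          (‖coeff x.1 f‖ * s ^ x.1) * (‖coeff x.2 g‖ * s ^ x.2) := by
        rw [Finset.sum_biUnion]
        intro i _ j _ hij
        refine Finset.disjoint_left.2 fun x hx hx' => hij ?_
        rw [← Finset.HasAntidiagonal.mem_antidiagonal.1 hx, Finset.HasAntidiagonal.mem_antidiagonal.1 hx']
    _ ≤ _ := by
        refine Finset.sum_le_sum_of_subset_of_nonneg ?_ fun _ _ _ => by positivity
        intro x hx
        simp only [Finset.mem_biUnion, Finset.mem_range, Finset.HasAntidiagonal.mem_antidiagonal,
          Finset.mem_product] at hx ⊢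
        omega

lemma partialNorm_C_le (a : ℂ) : partialNorm s N (C a) ≤ ‖a‖ := by
  rcases N with _ | N
  · simp [partialNorm]
  · simp [partialNorm, Finset.sum_range_succ', coeff_C]

lemma partialNorm_X_le (hs : 0 ≤ s) : partialNorm s N (X : ℂ⟦X⟧) ≤ s := by
  rcases N with _ | _ | N
  · simpa [partialNorm]
  · simpa [partialNorm]
  · simp [partialNorm, Finset.sum_range_succ', coeff_X]

lemma partialNorm_geometric_le (hs : 0 ≤ s) (hs' : s ≤ 1 / 2) :
    partialNorm s N (PowerSeries.mk 1 : ℂ⟦X⟧) ≤ 2 := by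
  have : partialNorm s N (PowerSeries.mk 1 : ℂ⟦X⟧) = ∑ n ∈ Finset.range N, s ^ n := by
    simp [partialNorm]
  rw [this]
  calc _ ≤ ∑' n, s ^ n :=
        (summable_geometric_of_lt_one hs (by linarith)).sum_le_tsum _ fun _ _ => by positivity
    _ = (1 - s)⁻¹ := tsum_geometric_of_lt_one hs (by linarith)
    _ ≤ (1 / 2)⁻¹ := by gcongr; linarith
    _ = 2 := by norm_num

lemma partialNorm_le_of_coeff_le {a b C : ℝ} {h : ℂ⟦X⟧} (hs : 0 ≤ s)
    (hcoeff : ∀ n, ‖coeff n f‖ ≤ C * ‖coeff n g‖ + C * ‖coeff n h‖) (hC : 0 ≤ C)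
    (hg : partialNorm s N g ≤ a) (hh : partialNorm s N h ≤ b) :
    partialNorm s N f ≤ C * a + C * b := by
  calc partialNorm s N f ≤ C * partialNorm s N g + C * partialNorm s N h := by
        unfold partialNorm
        rw [Finset.mul_sum, Finset.mul_sum, ← Finset.sum_add_distrib]
        refine Finset.sum_le_sum fun n _ => ?_
        calc _ ≤ (C * ‖coeff n g‖ + C * ‖coeff n h‖) * s ^ n := by gcongr; exact hcoeff n
          _ = _ := by ring
    _ ≤ _ := by gcongr

end PartialNorm

section Admissible

open PowerSeries

/-- Operators on pairs of power series that are `X`-adically nonexpanding and bounded, uniformly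
in the radius, on balls of the weighted `ℓ¹` norms. -/
def Admissible (Φ : ℂ⟦X⟧ × ℂ⟦X⟧ → ℂ⟦X⟧) : Prop :=
  (∀ n u v, X ^ n ∣ u.1 - v.1 → X ^ n ∣ u.2 - v.2 → X ^ n ∣ Φ u - Φ v) ∧
  ∀ δ : ℝ, ∃ B : ℝ, ∀ s : ℝ, 0 ≤ s → s ≤ 1 / 2 → ∀ N u,
    partialNorm s N u.1 ≤ δ → partialNorm s N u.2 ≤ δ → partialNorm s N (Φ u) ≤ B

namespace Admissible

variable {Φ Ψ : ℂ⟦X⟧ × ℂ⟦X⟧ → ℂ⟦X⟧}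

lemma fst : Admissible fun u => u.1 :=
  ⟨fun _ _ _ h _ => h, fun δ => ⟨δ, fun _ _ _ _ _ h _ => h⟩⟩

lemma snd : Admissible fun u => u.2 :=
  ⟨fun _ _ _ _ h => h, fun δ => ⟨δ, fun _ _ _ _ _ _ h => h⟩⟩

lemma const_C (a : ℂ) : Admissible fun _ => C a :=
  ⟨fun _ _ _ _ _ => by simp, fun _ => ⟨‖a‖, fun _ _ _ _ _ _ _ => partialNorm_C_le a⟩⟩

lemma const_X : Admissible fun _ => X :=
  ⟨fun _ _ _ _ _ => by simp,
    fun _ => ⟨1 / 2, fun _ h h' _ _ _ _ => (partialNorm_X_le h).trans h'⟩⟩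

lemma const_geometric : Admissible fun _ => PowerSeries.mk 1 :=
  ⟨fun _ _ _ _ _ => by simp,
    fun _ => ⟨2, fun _ h h' _ _ _ _ => partialNorm_geometric_le h h'⟩⟩

lemma add (h : Admissible Φ) (h' : Admissible Ψ) : Admissible fun u => Φ u + Ψ u := by
  refine ⟨fun n u v h₁ h₂ => ?_, fun δ => ?_⟩
  · rw [add_sub_add_comm]
    exact dvd_add (h.1 n u v h₁ h₂) (h'.1 n u v h₁ h₂)
  · obtain ⟨B, hB⟩ := h.2 δ
    obtain ⟨B', hB'⟩ := h'.2 δ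
    exact ⟨B + B', fun s hs hs' N u h₁ h₂ => (partialNorm_add_le hs).trans
      (add_le_add (hB s hs hs' N u h₁ h₂) (hB' s hs hs' N u h₁ h₂))⟩

lemma neg (h : Admissible Φ) : Admissible fun u => -Φ u := by
  refine ⟨fun n u v h₁ h₂ => ?_, fun δ => ?_⟩
  · rw [neg_sub_neg, ← neg_sub, dvd_neg]
    exact h.1 n u v h₁ h₂
  · obtain ⟨B, hB⟩ := h.2 δ
    exact ⟨B, fun s hs hs' N u h₁ h₂ => partialNorm_neg.trans_le (hB s hs hs' N u h₁ h₂)⟩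

lemma sub (h : Admissible Φ) (h' : Admissible Ψ) : Admissible fun u => Φ u - Ψ u := by
  simpa only [sub_eq_add_neg] using h.add h'.neg

lemma mul (h : Admissible Φ) (h' : Admissible Ψ) : Admissible fun u => Φ u * Ψ u := by
  refine ⟨fun n u v h₁ h₂ => ?_, fun δ => ?_⟩
  · have : Φ u * Ψ u - Φ v * Ψ v = Φ u * (Ψ u - Ψ v) + (Φ u - Φ v) * Ψ v := by ring
    rw [this]
    exact dvd_add ((h'.1 n u v h₁ h₂).mul_left _) ((h.1 n u v h₁ h₂).mul_right _)
  · obtain ⟨B, hB⟩ := h.2 δ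
    obtain ⟨B', hB'⟩ := h'.2 δ
    refine ⟨B * B', fun s hs hs' N u h₁ h₂ => (partialNorm_mul_le hs).trans ?_⟩
    have hu := hB s hs hs' N u h₁ h₂
    exact mul_le_mul hu (hB' s hs hs' N u h₁ h₂) (partialNorm_nonneg hs)
      ((partialNorm_nonneg hs).trans hu)

end Admissible

/-- For admissible `Φ₁`, `Φ₂`, the equation expressing each coefficient of `y` as a uniformly bounded
linear combination of the coefficients of `cᵢ + X Φᵢ(y)` has a convergent solution. -/
theorem exists_convergent_fixedPoint {Φ₁ Φ₂ : ℂ⟦X⟧ × ℂ⟦X⟧ → ℂ⟦X⟧}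
    (h₁ : Admissible Φ₁) (h₂ : Admissible Φ₂) (c₁ c₂ : ℂ) (α β γ δ : ℕ → ℂ) (M : ℝ)
    (hα : ∀ n, ‖α n‖ ≤ M) (hβ : ∀ n, ‖β n‖ ≤ M) (hγ : ∀ n, ‖γ n‖ ≤ M) (hδ : ∀ n, ‖δ n‖ ≤ M) :
    ∃ (y : ℂ⟦X⟧ × ℂ⟦X⟧) (s : ℝ), 0 < s ∧ s ≤ 1 / 2 ∧
      (Summable fun n => ‖coeff n y.1‖ * s ^ n) ∧ (Summable fun n => ‖coeff n y.2‖ * s ^ n) ∧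
      ∀ n, coeff n y.1 = α n * coeff n (C c₁ + X * Φ₁ y) + β n * coeff n (C c₂ + X * Φ₂ y) ∧
        coeff n y.2 = γ n * coeff n (C c₁ + X * Φ₁ y) + δ n * coeff n (C c₂ + X * Φ₂ y) := by
  have hM : 0 ≤ M := (norm_nonneg _).trans (hα 0)
  set R₁ : ℂ⟦X⟧ × ℂ⟦X⟧ → ℂ⟦X⟧ := fun y => C c₁ + X * Φ₁ y with hR₁
  set R₂ : ℂ⟦X⟧ × ℂ⟦X⟧ → ℂ⟦X⟧ := fun y => C c₂ + X * Φ₂ y with hR₂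
  set T : ℂ⟦X⟧ × ℂ⟦X⟧ → ℂ⟦X⟧ × ℂ⟦X⟧ := fun y =>
    (PowerSeries.mk fun n => α n * coeff n (R₁ y) + β n * coeff n (R₂ y),
      PowerSeries.mk fun n => γ n * coeff n (R₁ y) + δ n * coeff n (R₂ y)) with hT
  have hR : ∀ n u v, X ^ n ∣ u.1 - v.1 → X ^ n ∣ u.2 - v.2 →
      ∀ m < n + 1, coeff m (R₁ u) = coeff m (R₁ v) ∧ coeff m (R₂ u) = coeff m (R₂ v) := by
    intro n u v hu hv m hm
    have e₁ : X ^ (n + 1) ∣ R₁ u - R₁ v := by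
      have : R₁ u - R₁ v = X * (Φ₁ u - Φ₁ v) := by simp only [hR₁]; ring
      rw [this, pow_succ']
      exact mul_dvd_mul_left _ (h₁.1 n u v hu hv)
    have e₂ : X ^ (n + 1) ∣ R₂ u - R₂ v := by
      have : R₂ u - R₂ v = X * (Φ₂ u - Φ₂ v) := by simp only [hR₂]; ring
      rw [this, pow_succ']
      exact mul_dvd_mul_left _ (h₂.1 n u v hu hv)
    have e₁' := X_pow_dvd_iff.1 e₁ m hm
    have e₂' := X_pow_dvd_iff.1 e₂ m hm
    rw [map_sub, sub_eq_zero] at e₁' e₂'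
    exact ⟨e₁', e₂'⟩
  have hTc : ∀ n u v, X ^ n ∣ u.1 - v.1 → X ^ n ∣ u.2 - v.2 →
      X ^ (n + 1) ∣ (T u).1 - (T v).1 ∧ X ^ (n + 1) ∣ (T u).2 - (T v).2 := by
    intro n u v hu hv
    constructor <;> refine X_pow_dvd_iff.2 fun m hm => ?_ <;>
      simp [hT, (hR n u v hu hv m hm).1, (hR n u v hu hv m hm).2]
  set Y : ℕ → ℂ⟦X⟧ × ℂ⟦X⟧ := fun k => T^[k] 0 with hY
  have hYs : ∀ k, Y (k + 1) = T (Y k) := fun k => Function.iterate_succ_apply' _ _ _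
  have hstep : ∀ k, X ^ k ∣ (Y (k + 1)).1 - (Y k).1 ∧ X ^ k ∣ (Y (k + 1)).2 - (Y k).2 := by
    intro k
    induction k with
    | zero => simp
    | succ k ih => rw [hYs (k + 1)]; nth_rw 2 [hYs k]; nth_rw 3 [hYs k]; exact hTc k _ _ ih.1 ih.2
  have hstab : ∀ k j n, n < k → coeff n (Y (k + j)).1 = coeff n (Y k).1 ∧
      coeff n (Y (k + j)).2 = coeff n (Y k).2 := by
    intro k j n hn
    induction j with
    | zero => simp
    | succ j ih =>
      have e₁ := X_pow_dvd_iff.1 (hstep (k + j)).1 n (by omega)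
      have e₂ := X_pow_dvd_iff.1 (hstep (k + j)).2 n (by omega)
      rw [map_sub, sub_eq_zero] at e₁ e₂
      exact ⟨e₁.trans ih.1, e₂.trans ih.2⟩
  set y : ℂ⟦X⟧ × ℂ⟦X⟧ := (PowerSeries.mk fun n => coeff n (Y (n + 1)).1,
    PowerSeries.mk fun n => coeff n (Y (n + 1)).2) with hy
  have hyY : ∀ k n, n < k → coeff n y.1 = coeff n (Y k).1 ∧ coeff n y.2 = coeff n (Y k).2 := by
    intro k n hn
    obtain ⟨j, rfl⟩ : ∃ j, k = n + 1 + j := ⟨k - (n + 1), by omega⟩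
    have := hstab (n + 1) j n (by omega)
    simp only [hy, coeff_mk]
    exact ⟨this.1.symm, this.2.symm⟩
  set D : ℝ := M * (‖c₁‖ + 1) + M * (‖c₂‖ + 1) with hD
  have hD0 : 0 ≤ D := by positivity
  obtain ⟨B₁, hB₁⟩ := h₁.2 D
  obtain ⟨B₂, hB₂⟩ := h₂.2 D
  set s : ℝ := 1 / (2 + |B₁| + |B₂|) with hs
  have hs0 : 0 < s := by positivity
  have hs1 : s ≤ 1 / 2 := by
    rw [hs]
    gcongr
    linarith [abs_nonneg B₁, abs_nonneg B₂]
  have hsB : s * (2 + |B₁| + |B₂|) = 1 := by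
    rw [hs]
    field_simp
  have hbound : ∀ k N, partialNorm s N (Y k).1 ≤ D ∧ partialNorm s N (Y k).2 ≤ D := by
    intro k N
    induction k with
    | zero => simpa [hY, partialNorm] using hD0
    | succ k ih =>
      have est : ∀ (c : ℂ) (B : ℝ) (Φ : ℂ⟦X⟧), |B| ≤ 2 + |B₁| + |B₂| → partialNorm s N Φ ≤ B →
          partialNorm s N (C c + X * Φ) ≤ ‖c‖ + 1 := by
        intro c B Φ hB hΦ
        refine (partialNorm_add_le hs0.le).trans (add_le_add (partialNorm_C_le c) ?_)
        refine (partialNorm_mul_le hs0.le).trans ?_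
        rw [← hsB]
        exact mul_le_mul (partialNorm_X_le hs0.le) (hΦ.trans ((le_abs_self _).trans hB))
          (partialNorm_nonneg hs0.le) hs0.le
      have r₁ := est c₁ B₁ (Φ₁ (Y k)) (by linarith [abs_nonneg B₂])
        (hB₁ s hs0.le hs1 N _ ih.1 ih.2)
      have r₂ := est c₂ B₂ (Φ₂ (Y k)) (by linarith [abs_nonneg B₁])
        (hB₂ s hs0.le hs1 N _ ih.1 ih.2)
      have comb : ∀ (a b : ℂ) (u v : ℂ), ‖a‖ ≤ M → ‖b‖ ≤ M →
          ‖a * u + b * v‖ ≤ M * ‖u‖ + M * ‖v‖ := by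
        intro a b u v ha hb
        refine (norm_add_le _ _).trans ?_
        rw [norm_mul, norm_mul]
        gcongr
      rw [hYs]
      constructor
      · refine partialNorm_le_of_coeff_le hs0.le (fun n => ?_) hM r₁ r₂
        simpa only [hT, coeff_mk] using comb _ _ _ _ (hα n) (hβ n)
      · refine partialNorm_le_of_coeff_le hs0.le (fun n => ?_) hM r₁ r₂
        simpa only [hT, coeff_mk] using comb _ _ _ _ (hγ n) (hδ n)
  refine ⟨y, s, hs0, hs1, ?_, ?_, fun n => ?_⟩
  · refine summable_of_sum_range_le (c := D) (fun n => by positivity) fun N => ?_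
    refine le_of_eq_of_le (Finset.sum_congr rfl fun n hn => ?_) (hbound N N).1
    rw [(hyY N n (Finset.mem_range.1 hn)).1]
  · refine summable_of_sum_range_le (c := D) (fun n => by positivity) fun N => ?_
    refine le_of_eq_of_le (Finset.sum_congr rfl fun n hn => ?_) (hbound N N).2
    rw [(hyY N n (Finset.mem_range.1 hn)).2]
  · have hd₁ : X ^ n ∣ y.1 - (Y n).1 := X_pow_dvd_iff.2 fun m hm => by
      rw [map_sub, (hyY n m hm).1, sub_self]
    have hd₂ : X ^ n ∣ y.2 - (Y n).2 := X_pow_dvd_iff.2 fun m hm => by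
      rw [map_sub, (hyY n m hm).2, sub_self]
    obtain ⟨e₁, e₂⟩ := hR n y (Y n) hd₁ hd₂ n (by omega)
    obtain ⟨f₁, f₂⟩ := hyY (n + 1) n (by omega)
    simp only [hR₁, hR₂] at e₁ e₂
    rw [e₁, e₂, f₁, f₂, hYs]
    simp [hT, hR₁, hR₂]

end Admissible

lemma exists_norm_div_sq_sub_le (a b μ : ℂ) :
    ∃ M : ℝ, ∀ n : ℕ, ‖(a * (n + 1) + b) / (((n : ℂ) + 1) ^ 2 - μ)‖ ≤ M := by
  have h0 : Filter.Tendsto (fun n : ℕ => ((n : ℂ) + 1)⁻¹) Filter.atTop (nhds 0) := by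
    simpa using tendsto_one_div_add_atTop_nhds_zero_nat (𝕜 := ℂ)
  have h1 : Filter.Tendsto (fun n : ℕ => (a * ((n : ℂ) + 1)⁻¹ + b * (((n : ℂ) + 1)⁻¹) ^ 2) /
      (1 - μ * (((n : ℂ) + 1)⁻¹) ^ 2)) Filter.atTop
      (nhds ((a * 0 + b * 0 ^ 2) / (1 - μ * 0 ^ 2))) :=
    ((h0.const_mul a).add ((h0.pow 2).const_mul b)).div
      (tendsto_const_nhds.sub ((h0.pow 2).const_mul μ)) (by simp)
  obtain ⟨M, hM⟩ := (Metric.isBounded_range_of_tendsto _ h1).exists_norm_le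
  refine ⟨M, fun n => le_of_eq_of_le ?_ (hM _ ⟨n, rfl⟩)⟩
  have hn : (n : ℂ) + 1 ≠ 0 := by exact_mod_cast n.succ_ne_zero
  dsimp only
  rw [← mul_div_mul_right _ (1 - μ * (((n : ℂ) + 1)⁻¹) ^ 2) (pow_ne_zero 2 hn)]
  congr 1
  all_goals field_simp

section Evaluation

open PowerSeries

/-- The power series `f` converges at `z` with sum `w`. -/
def HasEvalAt (f : ℂ⟦X⟧) (z w : ℂ) : Prop :=
  HasSum (fun n => coeff n f * z ^ n) w

namespace HasEvalAt

variable {f g : ℂ⟦X⟧} {z u v : ℂ}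

lemma unique (h : HasEvalAt f z u) (h' : HasEvalAt f z v) : u = v := HasSum.unique h h'

lemma add (h : HasEvalAt f z u) (h' : HasEvalAt g z v) : HasEvalAt (f + g) z (u + v) := by
  simpa [HasEvalAt, add_mul] using HasSum.add h h'

lemma neg (h : HasEvalAt f z u) : HasEvalAt (-f) z (-u) := by
  simpa [HasEvalAt] using HasSum.neg h

lemma sub (h : HasEvalAt f z u) (h' : HasEvalAt g z v) : HasEvalAt (f - g) z (u - v) := by
  simpa only [sub_eq_add_neg] using h.add h'.neg

lemma mul (h : HasEvalAt f z u) (h' : HasEvalAt g z v) : HasEvalAt (f * g) z (u * v) := by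
  have hf := summable_norm_iff.2 (HasSum.summable h)
  have hg := summable_norm_iff.2 (HasSum.summable h')
  have key : (fun n => coeff n (f * g) * z ^ n) = fun n => ∑ x ∈ Finset.HasAntidiagonal.antidiagonal n,
      (coeff x.1 f * z ^ x.1) * (coeff x.2 g * z ^ x.2) := by
    ext n
    rw [coeff_mul, Finset.sum_mul]
    refine Finset.sum_congr rfl fun x hx => ?_
    rw [← Finset.HasAntidiagonal.mem_antidiagonal.1 hx, pow_add]
    ring
  have hs := summable_norm_sum_mul_antidiagonal_of_summable_norm hf hg
  have ht := tsum_mul_tsum_eq_tsum_sum_antidiagonal_of_summable_norm hf hg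
  rw [HasSum.tsum_eq h, HasSum.tsum_eq h'] at ht
  rw [HasEvalAt, key, ht]
  exact hs.of_norm.hasSum

lemma pow (h : HasEvalAt f z u) (n : ℕ) (hn : n ≠ 0) : HasEvalAt (f ^ n) z (u ^ n) := by
  induction n with
  | zero => exact absurd rfl hn
  | succ n ih =>
    rcases n with _ | n
    · simpa using h
    · rw [pow_succ f, pow_succ u]
      exact (ih (by simp)).mul h

lemma const (a z : ℂ) : HasEvalAt (C a) z a := by
  have := hasSum_single (f := fun n => coeff n (C a : ℂ⟦X⟧) * z ^ n) 0 fun n hn => by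
    simp [coeff_C, hn]
  simpa [HasEvalAt] using this

lemma var (z : ℂ) : HasEvalAt X z z := by
  have := hasSum_single (f := fun n => coeff n (X : ℂ⟦X⟧) * z ^ n) 1 fun n hn => by
    simp [coeff_X, hn]
  simpa [HasEvalAt] using this

end HasEvalAt

/-- A power series that converges absolutely at `s` has an analytic sum on the disc of radius
`s`, and its formal derivative sums to the derivative. -/
lemma exists_analytic_sum {f : ℂ⟦X⟧} {s : ℝ} (hf : Summable fun n => ‖coeff n f‖ * s ^ n) :
    ∃ F : ℂ → ℂ, (∀ z ∈ Metric.ball (0 : ℂ) s, AnalyticAt ℂ F z) ∧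
      (∀ z ∈ Metric.ball (0 : ℂ) s, HasEvalAt f z (F z)) ∧
      ∀ z ∈ Metric.ball (0 : ℂ) s, HasEvalAt (d⁄dX ℂ f) z (deriv F z) := by
  have hd : ∀ n : ℕ, DifferentiableOn ℂ (fun z => coeff n f * z ^ n) (Metric.ball (0 : ℂ) s) :=
    fun n => by fun_prop
  have hle : ∀ (n : ℕ), ∀ z ∈ Metric.ball (0 : ℂ) s,
      ‖coeff n f * z ^ n‖ ≤ ‖coeff n f‖ * s ^ n := by
    intro n z hz
    rw [mem_ball_zero_iff] at hz
    rw [norm_mul, norm_pow]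
    gcongr
  refine ⟨fun z => ∑' n, coeff n f * z ^ n, fun z hz => ?_, fun z hz => ?_, fun z hz => ?_⟩
  · exact (Complex.differentiableOn_tsum_of_summable_norm hf hd Metric.isOpen_ball hle).analyticAt
      (Metric.isOpen_ball.mem_nhds hz)
  · exact (Summable.of_norm_bounded hf fun n => hle n z hz).hasSum
  · have h := Complex.hasSum_deriv_of_summable_norm hf hd Metric.isOpen_ball hle hz
    rw [← hasSum_nat_add_iff' 1] at h
    simpa [HasEvalAt, coeff_derivative, mul_assoc] using h

end Evaluation

section BriotBouquet

open PowerSeries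

lemma add_mul_eq_of_eq_div {a b c t r₁ r₂ u v : ℂ} (ht : t ^ 2 - (a ^ 2 + b * c) ≠ 0)
    (hu : u = (1 * t + -a) / (t ^ 2 - (a ^ 2 + b * c)) * r₁
      + (0 * t + -b) / (t ^ 2 - (a ^ 2 + b * c)) * r₂)
    (hv : v = (0 * t + -c) / (t ^ 2 - (a ^ 2 + b * c)) * r₁
      + (1 * t + a) / (t ^ 2 - (a ^ 2 + b * c)) * r₂) :
    u * t = r₁ - a * u - b * v ∧ v * t = r₂ - c * u + a * v := by
  have hu_eq : (t ^ 2 - (a ^ 2 + b * c)) * u = (t - a) * r₁ - b * r₂ := by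
    rw [hu, mul_add, ← mul_assoc, ← mul_assoc, mul_div_cancel₀ _ ht, mul_div_cancel₀ _ ht]
    ring
  have hv_eq : (t ^ 2 - (a ^ 2 + b * c)) * v = -c * r₁ + (t + a) * r₂ := by
    rw [hv, mul_add, ← mul_assoc, ← mul_assoc, mul_div_cancel₀ _ ht, mul_div_cancel₀ _ ht]
    ring
  constructor <;> refine mul_left_cancel₀ ht ?_
  · linear_combination (t + a) * hu_eq + b * hv_eq
  · linear_combination c * hu_eq + (t - a) * hv_eq

/-- A Briot–Bouquet system `(z - 1) (z y)' = c + A y + z P(z, y)` with trace-free linear part `A`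
has a convergent power series solution if no eigenvalue of `A` is a nonzero integer. -/
theorem exists_convergent_solution {P₁ P₂ : ℂ⟦X⟧ × ℂ⟦X⟧ → ℂ⟦X⟧}
    (h₁ : Admissible P₁) (h₂ : Admissible P₂) (c₁ c₂ a b c : ℂ)
    (hdet : ∀ n : ℕ, ((n : ℂ) + 1) ^ 2 - (a ^ 2 + b * c) ≠ 0) :
    ∃ (y : ℂ⟦X⟧ × ℂ⟦X⟧) (s : ℝ), 0 < s ∧ s ≤ 1 / 2 ∧
      (Summable fun n => ‖coeff n y.1‖ * s ^ n) ∧ (Summable fun n => ‖coeff n y.2‖ * s ^ n) ∧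
      (X - 1) * d⁄dX ℂ (X * y.1) = C c₁ + C a * y.1 + C b * y.2 + X * P₁ y ∧
      (X - 1) * d⁄dX ℂ (X * y.2) = C c₂ + C c * y.1 - C a * y.2 + X * P₂ y := by
  set G : ℂ⟦X⟧ := PowerSeries.mk 1 with hG
  have hG1 : G * (1 - X) = 1 := PowerSeries.mk_one_mul_one_sub_eq_one ℂ
  have hGa : Admissible fun _ => G := Admissible.const_geometric
  obtain ⟨M₁, hM₁⟩ := exists_norm_div_sq_sub_le 1 (-a) (a ^ 2 + b * c)
  obtain ⟨M₂, hM₂⟩ := exists_norm_div_sq_sub_le 0 (-b) (a ^ 2 + b * c)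
  obtain ⟨M₃, hM₃⟩ := exists_norm_div_sq_sub_le 0 (-c) (a ^ 2 + b * c)
  obtain ⟨M₄, hM₄⟩ := exists_norm_div_sq_sub_le 1 a (a ^ 2 + b * c)
  have hΦ₁ : Admissible fun y => -(P₁ y + G * (C c₁ + C a * y.1 + C b * y.2 + X * P₁ y)) :=
    (h₁.add (hGa.mul ((((Admissible.const_C _).add ((Admissible.const_C _).mul .fst)).add
      ((Admissible.const_C _).mul .snd)).add (Admissible.const_X.mul h₁)))).neg
  have hΦ₂ : Admissible fun y => -(P₂ y + G * (C c₂ + C c * y.1 - C a * y.2 + X * P₂ y)) :=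
    (h₂.add (hGa.mul ((((Admissible.const_C _).add ((Admissible.const_C _).mul .fst)).sub
      ((Admissible.const_C _).mul .snd)).add (Admissible.const_X.mul h₂)))).neg
  obtain ⟨y, s, hs, hs', hy₁, hy₂, hy⟩ := exists_convergent_fixedPoint hΦ₁ hΦ₂ (-c₁) (-c₂)
    _ _ _ _ (max (max M₁ M₂) (max M₃ M₄))
    (fun n => (hM₁ n).trans (by simp)) (fun n => (hM₂ n).trans (by simp))
    (fun n => (hM₃ n).trans (by simp)) (fun n => (hM₄ n).trans (by simp))
  refine ⟨y, s, hs, hs', hy₁, hy₂, ?_, ?_⟩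
  · have key : d⁄dX ℂ (X * y.1) = C (-c₁) +
        X * -(P₁ y + G * (C c₁ + C a * y.1 + C b * y.2 + X * P₁ y)) - C a * y.1 - C b * y.2 := by
      ext n
      rw [coeff_derivative, coeff_succ_X_mul, map_sub, map_sub, coeff_C_mul, coeff_C_mul]
      exact (add_mul_eq_of_eq_div (hdet n) (hy n).1 (hy n).2).1
    rw [key, map_neg]
    linear_combination (X * (C c₁ + C a * y.1 + C b * y.2 + X * P₁ y)) * hG1
  · have key : d⁄dX ℂ (X * y.2) = C (-c₂) +
        X * -(P₂ y + G * (C c₂ + C c * y.1 - C a * y.2 + X * P₂ y)) - C c * y.1 + C a * y.2 := by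
      ext n
      rw [coeff_derivative, coeff_succ_X_mul, map_add, map_sub, coeff_C_mul, coeff_C_mul]
      exact (add_mul_eq_of_eq_div (hdet n) (hy n).1 (hy n).2).2
    rw [key, map_neg]
    linear_combination (X * (C c₂ + C c * y.1 - C a * y.2 + X * P₂ y)) * hG1

end BriotBouquet

section Painleve

open PowerSeries

/-- An equilibrium `(q₀, p₀)` of the sixth Painlevé system at `z = 0` whose linearisation has
nonresonant eigenvalues `±ν` extends to a holomorphic solution germ. -/
theorem exists_solvesPVIAt_of_equilibrium (κ₀ κ₁ κ₂ κ₃ κ₄ q₀ p₀ a b c ν : ℂ)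
    (hq : 2 * q₀ ^ 2 * (q₀ - 1) * p₀ - κ₁ * q₀ * (q₀ - 1) - (κ₂ - 1) * q₀ * (q₀ - 1)
      - κ₃ * q₀ ^ 2 = 0)
    (hp : -(3 * q₀ ^ 2 - 2 * q₀) * p₀ ^ 2
      + ((κ₁ + κ₂ - 1) * (2 * q₀ - 1) + 2 * κ₃ * q₀) * p₀ - κ₀ * (κ₀ + κ₄) = 0)
    (ha : a = 2 * (3 * q₀ ^ 2 - 2 * q₀) * p₀ - (κ₁ + κ₂ - 1) * (2 * q₀ - 1) - 2 * κ₃ * q₀)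
    (hb : b = 2 * q₀ ^ 2 * (q₀ - 1))
    (hc : c = -(6 * q₀ - 2) * p₀ ^ 2 + 2 * (κ₁ + κ₂ - 1 + κ₃) * p₀)
    (hν : a ^ 2 + b * c = ν ^ 2) (hν' : ∀ m : ℤ, ν ≠ m) :
    ∃ (r : ℝ) (q p : ℂ → ℂ), 0 < r ∧ r < 1 ∧
      (∀ z ∈ Metric.ball (0 : ℂ) r, AnalyticAt ℂ q z) ∧
      (∀ z ∈ Metric.ball (0 : ℂ) r, AnalyticAt ℂ p z) ∧
      q 0 = q₀ ∧
      ∀ z ∈ Metric.ball (0 : ℂ) r, SolvesPVIAt κ₀ κ₁ κ₂ κ₃ κ₄ q p z := by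
  have hdet : ∀ n : ℕ, ((n : ℂ) + 1) ^ 2 - (a ^ 2 + b * c) ≠ 0 := by
    intro n hn
    rw [hν, sub_eq_zero, sq_eq_sq_iff_eq_or_eq_neg] at hn
    rcases hn with hn | hn
    · exact hν' (n + 1) (by push_cast; exact hn.symm)
    · exact hν' (-(n + 1)) (by push_cast; rw [hn, neg_neg])
  have hqC : (C (2 * q₀ ^ 2 * (q₀ - 1) * p₀ - κ₁ * q₀ * (q₀ - 1) - (κ₂ - 1) * q₀ * (q₀ - 1)
      - κ₃ * q₀ ^ 2) : ℂ⟦X⟧) = 0 := by rw [hq, map_zero]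
  have hpC : (C (-(3 * q₀ ^ 2 - 2 * q₀) * p₀ ^ 2
      + ((κ₁ + κ₂ - 1) * (2 * q₀ - 1) + 2 * κ₃ * q₀) * p₀ - κ₀ * (κ₀ + κ₄)) : ℂ⟦X⟧) = 0 := by
    rw [hp, map_zero]
  set E : ℂ := 2 * q₀ * (q₀ - 1) * p₀ - κ₁ * (q₀ - 1) - κ₃ * q₀ with hE
  set F : ℂ := 3 * q₀ ^ 2 - 2 * q₀ with hF
  set m : ℂ := 2 * q₀ - 1 with hm
  set t : ℂ := κ₁ + κ₂ - 1 + κ₃ with ht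
  have hP₁ : Admissible fun y =>
      C (2 * q₀) * (C m * y.1 * y.2 + C p₀ * y.1 * y.1 + X * y.1 * y.1 * y.2)
      + (y.1 - C 1) * (C (2 * q₀ * (q₀ - 1)) * y.2 + C (2 * m * p₀ - κ₁ - κ₃) * y.1)
      + X * (y.1 - C 1) * (C 2 * (C m * y.1 * y.2 + C p₀ * y.1 * y.1 + X * y.1 * y.1 * y.2))
      - C (κ₂ - 1) * y.1 * y.1 := by
    with_reducible
      repeat' first
        | exact Admissible.fst | exact Admissible.snd | exact Admissible.const_X
        | exact Admissible.const_C _ | apply Admissible.sub | apply Admissible.add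
        | apply Admissible.mul
  have hP₂ : Admissible fun y =>
      (C (2 * t) * y.1 - C (κ₁ + κ₃)) * y.2 - C F * y.2 * y.2
      - (C (6 * q₀ - 2) * y.1 - C m) * (C (2 * p₀) * y.2 + X * y.2 * y.2)
      - (C 3 * y.1 * y.1 - C 2 * y.1) *
        (C (p₀ ^ 2) + X * (C (2 * p₀) * y.2 + X * y.2 * y.2)) := by
    with_reducible
      repeat' first
        | exact Admissible.fst | exact Admissible.snd | exact Admissible.const_X
        | exact Admissible.const_C _ | apply Admissible.sub | apply Admissible.add
        | apply Admissible.mul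
  obtain ⟨y, s, hs, hs', hy₁, hy₂, e₁, e₂⟩ := exists_convergent_solution hP₁ hP₂ (-E)
    (m * p₀ ^ 2 - (κ₁ + κ₃) * p₀) a b c hdet
  obtain ⟨f, hfa, hf, hf'⟩ := exists_analytic_sum (f := C q₀ + X * y.1) (s := s) (by
    rw [← summable_nat_add_iff 1]
    simpa [coeff_C, pow_succ, mul_assoc] using hy₁.mul_right s)
  obtain ⟨g, hga, hg, hg'⟩ := exists_analytic_sum (f := C p₀ + X * y.2) (s := s) (by
    rw [← summable_nat_add_iff 1]
    simpa [coeff_C, pow_succ, mul_assoc] using hy₂.mul_right s)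
  have i₁ : X * (X - C 1) * d⁄dX ℂ (C q₀ + X * y.1) =
      C 2 * (C q₀ + X * y.1) * (C q₀ + X * y.1 - C 1) * (C q₀ + X * y.1 - X) * (C p₀ + X * y.2)
        - C κ₁ * (C q₀ + X * y.1 - C 1) * (C q₀ + X * y.1 - X)
        - C (κ₂ - 1) * (C q₀ + X * y.1) * (C q₀ + X * y.1 - C 1)
        - C κ₃ * (C q₀ + X * y.1) * (C q₀ + X * y.1 - X) := by
    rw [map_add, derivative_C, zero_add]
    subst ha hb hc
    simp only [hE, hF, hm, map_add, map_sub, map_mul, map_neg, map_pow, map_one,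
      map_ofNat] at e₁ hqC ⊢
    linear_combination X * e₁ - hqC
  have i₂ : X * (X - C 1) * d⁄dX ℂ (C p₀ + X * y.2) =
      -(C 3 * (C q₀ + X * y.1) ^ 2 - C 2 * (C 1 + X) * (C q₀ + X * y.1) + X) * (C p₀ + X * y.2) ^ 2
        + (C κ₁ * (C 2 * (C q₀ + X * y.1) - C 1 - X) + C (κ₂ - 1) * (C 2 * (C q₀ + X * y.1) - C 1)
          + C κ₃ * (C 2 * (C q₀ + X * y.1) - X)) * (C p₀ + X * y.2) - C (κ₀ * (κ₀ + κ₄)) := by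
    rw [map_add, derivative_C, zero_add]
    subst ha hb hc
    simp only [hF, hm, ht, map_add, map_sub, map_mul, map_neg, map_pow, map_one,
      map_ofNat] at e₂ hpC ⊢
    linear_combination X * e₂ - hpC
  refine ⟨s, f, g, hs, by linarith, hfa, hga, ?_, fun z hz => ⟨?_, ?_⟩⟩
  · have h0 : (0 : ℂ) ∈ Metric.ball (0 : ℂ) s := Metric.mem_ball_self hs
    have h1 : HasEvalAt (C q₀ + X * y.1) 0 q₀ := by
      have := hasSum_single (f := fun n => coeff n (C q₀ + X * y.1) * (0 : ℂ) ^ n) 0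
        fun n hn => by simp [hn]
      simpa [HasEvalAt] using this
    exact (hf 0 h0).unique h1
  · have k (w : ℂ) := HasEvalAt.const w z
    have x := HasEvalAt.var z
    have Q := hf z hz
    have P := hg z hz
    have L := (x.mul (x.sub (k 1))).mul (hf' z hz)
    rw [i₁] at L
    exact L.unique ((((((((k 2).mul Q).mul (Q.sub (k 1))).mul (Q.sub x)).mul P).sub
      (((k κ₁).mul (Q.sub (k 1))).mul (Q.sub x))).sub
      (((k (κ₂ - 1)).mul Q).mul (Q.sub (k 1)))).sub (((k κ₃).mul Q).mul (Q.sub x)))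
  · have k (w : ℂ) := HasEvalAt.const w z
    have x := HasEvalAt.var z
    have Q := hf z hz
    have P := hg z hz
    have L := (x.mul (x.sub (k 1))).mul (hg' z hz)
    rw [i₂] at L
    exact L.unique ((((((k 3).mul (Q.pow 2 two_ne_zero)).sub
      (((k 2).mul ((k 1).add x)).mul Q)).add x).neg.mul (P.pow 2 two_ne_zero)).add
      (((((k κ₁).mul ((((k 2).mul Q).sub (k 1)).sub x)).add
      ((k (κ₂ - 1)).mul (((k 2).mul Q).sub (k 1)))).add
      ((k κ₃).mul (((k 2).mul Q).sub x))).mul P) |>.sub (k (κ₀ * (κ₀ + κ₄))))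

end Painleve

/-- If `κ₄ ≠ 0` and `κ₄ + εκ₃ ∉ ℤ` for a sign `ε ∈ {±1}`, Painlevé VI admits a
holomorphic solution germ at `z = 0` with `q(z) = (κ₄+εκ₃)/κ₄ + O(z)`. -/
theorem holomorphic_solution_germ_k4_k3
    (κ₀ κ₁ κ₂ κ₃ κ₄ : ℂ) (hκ : 2 * κ₀ + κ₁ + κ₂ + κ₃ + κ₄ = 1)
    (hκ₄ : κ₄ ≠ 0) (ε : ℂ) (hε : ε = 1 ∨ ε = -1)
    (h : ∀ m : ℤ, κ₄ + ε * κ₃ ≠ (m : ℂ)) :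
    ∃ (r : ℝ) (q p : ℂ → ℂ), 0 < r ∧ r < 1 ∧
      (∀ z ∈ Metric.ball (0 : ℂ) r, AnalyticAt ℂ q z) ∧
      (∀ z ∈ Metric.ball (0 : ℂ) r, AnalyticAt ℂ p z) ∧
      q 0 = (κ₄ + ε * κ₃) / κ₄ ∧
      ∀ z ∈ Metric.ball (0 : ℂ) r, z ≠ 0 → SolvesPVIAt κ₀ κ₁ κ₂ κ₃ κ₄ q p z := by
  have hε2 : ε ^ 2 = 1 := by rcases hε with rfl | rfl <;> norm_num
  obtain rfl : κ₂ = 1 - 2 * κ₀ - κ₁ - κ₃ - κ₄ := by linear_combination hκ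
  obtain ⟨ν, hν⟩ : ∃ ν, ν = κ₄ + ε * κ₃ := ⟨_, rfl⟩
  obtain rfl : κ₃ = ε * (ν - κ₄) := by linear_combination -ε * hν - κ₃ * hε2
  rw [← hν] at h ⊢
  have hν0 : ν ≠ 0 := by simpa using h 0
  obtain ⟨r, q, p, hr, hr1, hq, hp, hq0, hsol⟩ := exists_solvesPVIAt_of_equilibrium
    κ₀ κ₁ (1 - 2 * κ₀ - κ₁ - ε * (ν - κ₄) - κ₄) (ε * (ν - κ₄)) κ₄ (ν / κ₄)
    (-(κ₀ + (1 - ε) / 2 * κ₄) * κ₄ / ν) _ _ _ ν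
    (by rcases hε with rfl | rfl <;> field_simp <;> ring)
    (by rcases hε with rfl | rfl <;> field_simp <;> ring) rfl rfl rfl
    (by rcases hε with rfl | rfl <;> field_simp <;> ring) h
  exact ⟨r, q, p, hr, hr1, hq, hp, hq0, fun z hz _ => hsol z hz⟩
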